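/- Let n ≥ 2 and let f : ℝⁿ → ℝ be a C² function whose graph has constant scalar curvature R ≥ 0, i.e. there is a constant c ≥ 0 with R(x) = c for all x ∈ ℝⁿ. Then c = 0. -/

import Mathlib

open Metric Finset

/-- Coordinates of the gradient of `f` at `x`. -/
noncomputable def grad (n : ℕ) (f : EuclideanSpace ℝ (Fin n) → ℝ)
    (x : EuclideanSpace ℝ (Fin n)) : Fin n → ℝ :=
  fun i => fderiv ℝ f x (EuclideanSpace.single i 1)

/-- The Hessian matrix `D²f(x)`. -/
noncomputable def hess (n : ℕ) (f : EuclideanSpace ℝ (Fin n) → ℝ)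
    (x : EuclideanSpace ℝ (Fin n)) : Matrix (Fin n) (Fin n) ℝ :=
  Matrix.of fun i j =>
    fderiv ℝ (fun y => fderiv ℝ f y (EuclideanSpace.single j 1)) x (EuclideanSpace.single i 1)

/-- `|∇f(x)|²`. -/
noncomputable def gradSq (n : ℕ) (f : EuclideanSpace ℝ (Fin n) → ℝ)
    (x : EuclideanSpace ℝ (Fin n)) : ℝ :=
  ∑ i, grad n f x i ^ 2

/-- The shape operator of the graph of `f`, with respect to the upward unit normal:
`W(x) = (1+|∇f|²)^{-1/2} (Iₙ - ∇f ∇fᵀ/(1+|∇f|²)) D²f(x)`. -/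
noncomputable def shapeOp (n : ℕ) (f : EuclideanSpace ℝ (Fin n) → ℝ)
    (x : EuclideanSpace ℝ (Fin n)) : Matrix (Fin n) (Fin n) ℝ :=
  (Real.sqrt (1 + gradSq n f x))⁻¹ •
    (((1 : Matrix (Fin n) (Fin n) ℝ) -
      Matrix.of fun i j => grad n f x i * grad n f x j / (1 + gradSq n f x)) * hess n f x)

/-- The mean curvature `H(x) = tr W(x) / n`. -/
noncomputable def meanCurv (n : ℕ) (f : EuclideanSpace ℝ (Fin n) → ℝ)
    (x : EuclideanSpace ℝ (Fin n)) : ℝ :=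
  (shapeOp n f x).trace / n

/-- The scalar curvature `R(x) = ((tr W)² - tr(W²)) / (n(n-1))`. -/
noncomputable def scalarCurv (n : ℕ) (f : EuclideanSpace ℝ (Fin n) → ℝ)
    (x : EuclideanSpace ℝ (Fin n)) : ℝ :=
  ((shapeOp n f x).trace ^ 2 - (shapeOp n f x * shapeOp n f x).trace) /
    ((n : ℝ) * ((n : ℝ) - 1))

/-- The length `|A|(x) = √(tr(W(x)²))` of the second fundamental form. -/
noncomputable def normA (n : ℕ) (f : EuclideanSpace ℝ (Fin n) → ℝ)
    (x : EuclideanSpace ℝ (Fin n)) : ℝ :=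
  Real.sqrt ((shapeOp n f x * shapeOp n f x).trace)

/-- A bounded `C¹` vector field on `ℝ^{m+1}` cannot have divergence bounded below by a positive
constant. -/
theorem nonpos_of_le_divergence_of_bounded {m : ℕ}
    (v : Fin (m + 1) → (Fin (m + 1) → ℝ) → ℝ) (hv : ∀ i, ContDiff ℝ 1 (v i))
    (hb : ∀ i x, |v i x| ≤ 1) {δ : ℝ}
    (hd : ∀ x, δ ≤ ∑ i, fderiv ℝ (v i) x (Pi.single i 1)) : δ ≤ 0 := by
  by_contra! hδ
  obtain ⟨r, hr, hδr⟩ : ∃ r : ℝ, 0 < r ∧ 2 * ((m : ℝ) + 1) < δ * r := by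
    refine ⟨(2 * ((m : ℝ) + 1) + 1) / δ, by positivity, ?_⟩
    rw [mul_div_cancel₀ _ hδ.ne']
    linarith
  have hcont : Continuous fun x => ∑ i, fderiv ℝ (v i) x (Pi.single i 1) :=
    continuous_finsetSum _ fun i _ =>
      ((hv i).continuous_fderiv one_ne_zero).clm_apply continuous_const
  have hint : MeasureTheory.IntegrableOn (fun x => ∑ i, fderiv ℝ (v i) x (Pi.single i 1))
      (Set.Icc (0 : Fin (m + 1) → ℝ) (fun _ => r)) MeasureTheory.volume :=
    hcont.continuousOn.integrableOn_compact isCompact_Icc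
  have hdiv := MeasureTheory.integral_divergence_of_hasFDerivAt_off_countable'
    (0 : Fin (m + 1) → ℝ) (fun _ => r) (fun _ => hr.le) v (fun i => fderiv ℝ (v i)) ∅
    Set.countable_empty (fun i => (hv i).continuous.continuousOn)
    (fun x _ i => ((hv i).differentiable one_ne_zero x).hasFDerivAt) hint
  have hvol (k : ℕ) : MeasureTheory.volume.real
      (Set.Icc (0 : Fin k → ℝ) (fun _ => r)) = r ^ k := by
    rw [MeasureTheory.measureReal_def,
      Real.volume_Icc_pi_toReal (show (0 : Fin k → ℝ) ≤ fun _ => r from fun _ => hr.le)]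
    simp
  have hlow : δ * r ^ (m + 1) ≤
      ∫ x in Set.Icc (0 : Fin (m + 1) → ℝ) (fun _ => r),
        ∑ i, fderiv ℝ (v i) x (Pi.single i 1) := by
    have hconst : MeasureTheory.IntegrableOn (fun _ => δ)
        (Set.Icc (0 : Fin (m + 1) → ℝ) (fun _ => r)) MeasureTheory.volume :=
      continuous_const.continuousOn.integrableOn_compact isCompact_Icc
    have h := MeasureTheory.setIntegral_mono_on hconst hint measurableSet_Icc (fun x _ => hd x)
    rw [MeasureTheory.setIntegral_const, hvol, smul_eq_mul] at h
    linarith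
  have hface (i : Fin (m + 1)) (t : ℝ) :
      |∫ x in Set.Icc (0 : Fin m → ℝ) (fun _ => r), v i (i.insertNth t x)| ≤ r ^ m := by
    have h := MeasureTheory.norm_setIntegral_le_of_norm_le_const (C := 1)
      (μ := MeasureTheory.volume)
      (f := fun x : Fin m → ℝ => v i (i.insertNth t x))
      (isCompact_Icc (a := (0 : Fin m → ℝ)) (b := fun _ => r)).measure_lt_top
      (fun x _ => hb i _)
    rwa [hvol, one_mul] at h
  have hup : ∫ x in Set.Icc (0 : Fin (m + 1) → ℝ) (fun _ => r),
      ∑ i, fderiv ℝ (v i) x (Pi.single i 1) ≤ ∑ _i : Fin (m + 1), 2 * r ^ m := by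
    rw [hdiv]
    refine Finset.sum_le_sum fun i _ => ?_
    have h₁ := (abs_le.mp (hface i r)).2
    have h₂ := (abs_le.mp (hface i 0)).1
    change (∫ x in Set.Icc (0 : Fin m → ℝ) (fun _ => r), v i (i.insertNth r x)) -
      (∫ x in Set.Icc (0 : Fin m → ℝ) (fun _ => r), v i (i.insertNth 0 x)) ≤ _
    linarith
  simp only [Finset.sum_const, Finset.card_univ, Fintype.card_fin, nsmul_eq_mul] at hup
  push_cast at hup
  have hrm : 0 < r ^ m := pow_pos hr m
  have : δ * r ^ (m + 1) = δ * r * r ^ m := by ring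
  nlinarith

open scoped MatrixOrder in
/-- If `P` is positive semidefinite and `A` is symmetric, then `tr((PA)²) ≥ 0`. -/
theorem Matrix.PosSemidef.trace_mul_isSymm_sq_nonneg {n : ℕ} {P A : Matrix (Fin n) (Fin n) ℝ}
    (hP : P.PosSemidef) (hA : A.IsSymm) : 0 ≤ ((P * A) * (P * A)).trace := by
  obtain ⟨B, hB⟩ := CStarAlgebra.nonneg_iff_eq_star_mul_self.mp hP.nonneg
  rw [Matrix.star_eq_conjTranspose] at hB
  subst hB
  have hAH : A.conjTranspose = A := by
    rw [Matrix.conjTranspose_eq_transpose_of_trivial, hA.eq]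
  have h : ((B.conjTranspose * B * A) * (B.conjTranspose * B * A)).trace =
      ((B * A * B.conjTranspose).conjTranspose * (B * A * B.conjTranspose)).trace := by
    simp only [Matrix.conjTranspose_mul, Matrix.conjTranspose_conjTranspose, hAH, Matrix.mul_assoc]
    rw [Matrix.trace_mul_comm]
    simp only [Matrix.mul_assoc]
  rw [h]
  exact (Matrix.posSemidef_conjTranspose_mul_self _).trace_nonneg

/-- The matrix `I - p pᵀ / (1 + |p|²)` is positive semidefinite. -/
theorem posSemidef_one_sub_outer_div {n : ℕ} (p : Fin n → ℝ) :
    ((1 : Matrix (Fin n) (Fin n) ℝ) -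
      Matrix.of fun i j => p i * p j / (1 + ∑ k, p k ^ 2)).PosSemidef := by
  refine Matrix.PosSemidef.of_dotProduct_mulVec_nonneg ?_ fun x => ?_
  · ext i j
    simp [Matrix.one_apply, eq_comm, mul_comm]
  · have hS : 0 ≤ ∑ k, p k ^ 2 := Finset.sum_nonneg fun k _ => sq_nonneg _
    have hq : star x ⬝ᵥ (((1 : Matrix (Fin n) (Fin n) ℝ) -
        Matrix.of fun i j => p i * p j / (1 + ∑ k, p k ^ 2)).mulVec x) =
        ∑ i, x i ^ 2 - (∑ i, p i * x i) ^ 2 / (1 + ∑ k, p k ^ 2) := by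
      rw [Matrix.sub_mulVec, Matrix.one_mulVec, dotProduct_sub]
      congr 1
      · simp [dotProduct, sq]
      · rw [sq (∑ i, p i * x i), Finset.sum_mul_sum]
        simp only [dotProduct, Matrix.mulVec, Matrix.of_apply, Pi.star_apply, star_trivial,
          Finset.sum_div, Finset.mul_sum]
        refine Finset.sum_congr rfl fun i _ => Finset.sum_congr rfl fun j _ => ?_
        ring
    rw [hq, sub_nonneg, div_le_iff₀ (by positivity)]
    have hx : 0 ≤ ∑ i, x i ^ 2 := Finset.sum_nonneg fun k _ => sq_nonneg _
    have hcs := Finset.sum_mul_sq_le_sq_mul_sq Finset.univ p x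
    nlinarith

theorem gradSq_nonneg (n : ℕ) (f : EuclideanSpace ℝ (Fin n) → ℝ)
    (x : EuclideanSpace ℝ (Fin n)) : 0 ≤ gradSq n f x :=
  Finset.sum_nonneg fun _ _ => sq_nonneg _

theorem contDiff_grad {n : ℕ} {f : EuclideanSpace ℝ (Fin n) → ℝ} (hf : ContDiff ℝ 2 f)
    (i : Fin n) : ContDiff ℝ 1 fun x => grad n f x i :=
  (hf.fderiv_right (m := 1) (by norm_num)).clm_apply contDiff_const

theorem contDiff_sqrt_one_add_gradSq {n : ℕ} {f : EuclideanSpace ℝ (Fin n) → ℝ}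
    (hf : ContDiff ℝ 2 f) : ContDiff ℝ 1 fun x => Real.sqrt (1 + gradSq n f x) :=
  (contDiff_const.add (ContDiff.sum fun i _ => (contDiff_grad hf i).pow 2)).sqrt fun x =>
    (add_pos_of_pos_of_nonneg one_pos (gradSq_nonneg n f x)).ne'

theorem isSymm_hess {n : ℕ} {f : EuclideanSpace ℝ (Fin n) → ℝ} (hf : ContDiff ℝ 2 f)
    (x : EuclideanSpace ℝ (Fin n)) : (hess n f x).IsSymm := by
  have hd : DifferentiableAt ℝ (fderiv ℝ f) x :=
    (hf.fderiv_right (m := 1) (by norm_num)).differentiable one_ne_zero x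
  have hs : IsSymmSndFDerivAt ℝ f x := hf.contDiffAt.isSymmSndFDerivAt (by simp)
  have hess_apply (i j : Fin n) : hess n f x i j =
      fderiv ℝ (fderiv ℝ f) x (EuclideanSpace.single i 1) (EuclideanSpace.single j 1) := by
    rw [hess, Matrix.of_apply, fderiv_clm_apply hd (differentiableAt_const _)]
    simp
  ext i j
  rw [Matrix.transpose_apply, hess_apply, hess_apply]
  exact hs _ _

theorem trace_shapeOp_sq_nonneg {n : ℕ} {f : EuclideanSpace ℝ (Fin n) → ℝ}
    (hf : ContDiff ℝ 2 f) (x : EuclideanSpace ℝ (Fin n)) :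
    0 ≤ (shapeOp n f x * shapeOp n f x).trace := by
  have h := (posSemidef_one_sub_outer_div (grad n f x)).trace_mul_isSymm_sq_nonneg
    (isSymm_hess hf x)
  rw [shapeOp, Matrix.smul_mul, Matrix.mul_smul, Matrix.trace_smul, Matrix.trace_smul]
  have hs := inv_nonneg.mpr (Real.sqrt_nonneg (1 + gradSq n f x))
  exact smul_nonneg hs (smul_nonneg hs h)

/-- The field `∇f / √(1+|∇f|²)`, the horizontal part of the downward unit normal. -/
noncomputable def normalizedGrad (n : ℕ) (f : EuclideanSpace ℝ (Fin n) → ℝ) (i : Fin n)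
    (x : EuclideanSpace ℝ (Fin n)) : ℝ :=
  grad n f x i / Real.sqrt (1 + gradSq n f x)

theorem contDiff_normalizedGrad {n : ℕ} {f : EuclideanSpace ℝ (Fin n) → ℝ}
    (hf : ContDiff ℝ 2 f) (i : Fin n) : ContDiff ℝ 1 (normalizedGrad n f i) :=
  (contDiff_grad hf i).div (contDiff_sqrt_one_add_gradSq hf) fun x =>
    (Real.sqrt_pos.mpr (add_pos_of_pos_of_nonneg one_pos (gradSq_nonneg n f x))).ne'

theorem abs_normalizedGrad_le_one (n : ℕ) (f : EuclideanSpace ℝ (Fin n) → ℝ) (i : Fin n)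
    (x : EuclideanSpace ℝ (Fin n)) : |normalizedGrad n f i x| ≤ 1 := by
  have hi : grad n f x i ^ 2 ≤ gradSq n f x :=
    Finset.single_le_sum (f := fun j => grad n f x j ^ 2) (fun _ _ => sq_nonneg _)
      (Finset.mem_univ i)
  rw [normalizedGrad, abs_div, abs_of_nonneg (Real.sqrt_nonneg _)]
  exact div_le_one_of_le₀ (Real.abs_le_sqrt (by linarith)) (Real.sqrt_nonneg _)

/-- The trace of the shape operator is the divergence of `∇f / √(1+|∇f|²)`. -/
theorem trace_shapeOp_eq_divergence {n : ℕ} {f : EuclideanSpace ℝ (Fin n) → ℝ}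
    (hf : ContDiff ℝ 2 f) (x : EuclideanSpace ℝ (Fin n)) :
    (shapeOp n f x).trace =
      ∑ i, fderiv ℝ (normalizedGrad n f i) x (EuclideanSpace.single i 1) := by
  have hpos : 0 < 1 + gradSq n f x :=
    add_pos_of_pos_of_nonneg one_pos (gradSq_nonneg n f x)
  set s := Real.sqrt (1 + gradSq n f x) with hs
  have hs0 : s ≠ 0 := (Real.sqrt_pos.mpr hpos).ne'
  have hs2 : 1 + gradSq n f x = s ^ 2 := (Real.sq_sqrt hpos.le).symm
  have hg (i : Fin n) : HasFDerivAt (fun y => grad n f y i)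
      (fderiv ℝ (fun y => grad n f y i) x) x :=
    ((contDiff_grad hf i).differentiable one_ne_zero x).hasFDerivAt
  have hG : HasFDerivAt (fun y => 1 + gradSq n f y)
      (∑ j, (2 * grad n f x j) • fderiv ℝ (fun y => grad n f y j) x) x := by
    refine HasFDerivAt.const_add 1 ?_
    have := HasFDerivAt.fun_sum (u := Finset.univ) fun j _ => (hg j).pow 2
    have hgs : gradSq n f = fun y => ∑ j, grad n f y j ^ 2 := rfl
    simpa [hgs] using this
  have hS := hG.sqrt hpos.ne'
  have hdiv (i : Fin n) :
      fderiv ℝ (normalizedGrad n f i) x (EuclideanSpace.single i 1) =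
        s⁻¹ * (hess n f x i i - ∑ j, grad n f x i * grad n f x j / s ^ 2 * hess n f x i j) := by
    have h := ((hg i).mul ((hasDerivAt_inv hs0).comp_hasFDerivAt x hS)).fderiv
    have hv : normalizedGrad n f i =
        (fun y => grad n f y i) * (Inv.inv ∘ fun y => Real.sqrt (1 + gradSq n f y)) := by
      ext y
      simp [normalizedGrad, div_eq_mul_inv]
    have hh (j : Fin n) : fderiv ℝ (fun y => grad n f y j) x (EuclideanSpace.single i 1) =
        hess n f x i j := rfl
    rw [hv, h]
    simp only [add_apply, smul_apply, _root_.sum_apply, smul_eq_mul, hh, Function.comp_apply, ← hs]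
    have hsum : ∑ j, 2 * grad n f x j * hess n f x i j =
        2 * ∑ j, grad n f x j * hess n f x i j := by
      simp only [Finset.mul_sum, mul_assoc]
    have hsum' : ∑ j, grad n f x i * grad n f x j / s ^ 2 * hess n f x i j =
        grad n f x i / s ^ 2 * ∑ j, grad n f x j * hess n f x i j := by
      rw [Finset.mul_sum]
      exact Finset.sum_congr rfl fun j _ => by ring
    rw [hsum, hsum']
    field_simp
    ring
  rw [Finset.sum_congr rfl fun i _ => hdiv i, ← Finset.mul_sum, Finset.sum_sub_distrib,
    Finset.sum_comm, shapeOp, Matrix.trace_smul, ← hs, smul_eq_mul, Matrix.sub_mul,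
    Matrix.one_mul, Matrix.trace_sub, hs2]
  simp only [Matrix.trace, Matrix.diag_apply, Matrix.mul_apply, Matrix.of_apply]
  congr 2
  exact Finset.sum_congr rfl fun i _ => Finset.sum_congr rfl fun j _ => by ring

/-- The trace of the shape operator of an entire graph is not bounded away from zero. -/
theorem nonpos_of_le_trace_shapeOp_sq {m : ℕ} {f : EuclideanSpace ℝ (Fin (m + 1)) → ℝ}
    (hf : ContDiff ℝ 2 f) {a : ℝ} (ha : ∀ x, a ≤ (shapeOp (m + 1) f x).trace ^ 2) : a ≤ 0 := by
  by_contra! hpos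
  let e := (EuclideanSpace.equiv (Fin (m + 1)) ℝ).symm
  let v : Fin (m + 1) → (Fin (m + 1) → ℝ) → ℝ := fun i y => normalizedGrad (m + 1) f i (e y)
  have hv (i) : ContDiff ℝ 1 (v i) := (contDiff_normalizedGrad hf i).comp e.contDiff
  have hvb (i y) : |v i y| ≤ 1 := abs_normalizedGrad_le_one _ _ _ _
  have hvd (y) : ∑ i, fderiv ℝ (v i) y (Pi.single i 1) = (shapeOp (m + 1) f (e y)).trace := by
    rw [trace_shapeOp_eq_divergence hf]
    refine Finset.sum_congr rfl fun i _ => ?_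
    have h := (((contDiff_normalizedGrad hf i).differentiable one_ne_zero (e y)).hasFDerivAt.comp y
      e.hasFDerivAt).fderiv
    change fderiv ℝ (normalizedGrad (m + 1) f i ∘ e) y _ = _
    rw [h]
    rfl
  let T : (Fin (m + 1) → ℝ) → ℝ := fun y => ∑ i, fderiv ℝ (v i) y (Pi.single i 1)
  have hT : Continuous T := continuous_finsetSum _ fun i _ =>
    ((hv i).continuous_fderiv one_ne_zero).clm_apply continuous_const
  have hTa (y) : a ≤ T y ^ 2 := by simpa only [T, hvd] using ha (e y)
  have hT0 (y) : T y ≠ 0 := fun h => by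
    have := hTa y
    rw [h] at this
    linarith
  have habs (y) : Real.sqrt a ≤ |T y| := Real.sqrt_le_iff.mpr ⟨abs_nonneg _, by simpa using hTa y⟩
  have hsign : (∀ y, 0 < T y) ∨ ∀ y, T y < 0 := by
    by_contra! h
    obtain ⟨⟨y, hy⟩, z, hz⟩ := h
    obtain ⟨w, hw⟩ := intermediate_value_univ y z hT ⟨hy, hz⟩
    exact hT0 w hw
  refine (Real.sqrt_pos.mpr hpos).not_ge ?_
  rcases hsign with h | h
  · exact nonpos_of_le_divergence_of_bounded v hv hvb fun y => by
      simpa only [abs_of_pos (h y)] using habs y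
  · refine nonpos_of_le_divergence_of_bounded (fun i y => -v i y) (fun i => (hv i).neg)
      (fun i y => by simpa using hvb i y) fun y => ?_
    have := habs y
    rw [abs_of_neg (h y)] at this
    simpa [T, fderiv_fun_neg] using this

/-- An entire graph in `ℝ^{n+1}` with constant scalar curvature `R = c ≥ 0`
satisfies `c = 0` (consequence of the Chern–Flanders theorem via the
Gauss equation `n²H² = |A|² + n(n-1)R`). -/
theorem scalarCurv_eq_zero_of_constant_nonneg
    (n : ℕ) (hn : 2 ≤ n)
    (f : EuclideanSpace ℝ (Fin n) → ℝ) (hf : ContDiff ℝ 2 f)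
    (c : ℝ) (hc : 0 ≤ c) (hR : ∀ x : EuclideanSpace ℝ (Fin n), scalarCurv n f x = c) :
    c = 0 := by
  obtain ⟨m, rfl⟩ : ∃ m, n = m + 1 := ⟨n - 1, by omega⟩
  have hm : (2 : ℝ) ≤ ((m + 1 : ℕ) : ℝ) := by exact_mod_cast hn
  have hk : 0 < ((m + 1 : ℕ) : ℝ) * (((m + 1 : ℕ) : ℝ) - 1) :=
    mul_pos (by linarith) (by linarith)
  have h : c * (((m + 1 : ℕ) : ℝ) * (((m + 1 : ℕ) : ℝ) - 1)) ≤ 0 := by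
    refine nonpos_of_le_trace_shapeOp_sq hf fun x => ?_
    have hx := hR x
    rw [scalarCurv, div_eq_iff hk.ne'] at hx
    linarith [trace_shapeOp_sq_nonneg hf x]
  exact le_antisymm (nonpos_of_mul_nonpos_left h hk) hc
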